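/- arXiv:2011.14741 — 3 statements merged into one kernel-verified Lean document; each statement's English description precedes it below -/
import Mathlib

section
/- Let W be a channel from a finite alphabet 𝒳 to a finite alphabet 𝒴, let Q be a distribution on 𝒴, let γ ∈ ℝ, and set S = S(Q,γ) = {(x,y) ∈ 𝒳×𝒴 : W(y|x) ≤ e^γ Q(y)}. Let P be a distribution on 𝒳, let M ≥ 1 be an integer, let X_1, …, X_M be independent random variables each distributed according to P, and define the random empirical distribution P̃_𝒞(x) = (1/M)∑_{i=1}^M 1[X_i = x]. Then E[ d(P̃_𝒞 W^S, P W^S) ] ≤ (1/2)√(e^γ/M), where the expectation is over the random codebook (X_1,…,X_M). -/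
open Finset

/-- `p` is a probability distribution on a finite type. -/
def IsDist {Z : Type*} [Fintype Z] (p : Z → ℝ) : Prop :=
  (∀ z, 0 ≤ p z) ∧ ∑ z, p z = 1

/-- `W` is a channel from `A` to `B`. -/
def IsChannel {A B : Type*} [Fintype A] [Fintype B] (W : A → B → ℝ) : Prop :=
  (∀ x y, 0 ≤ W x y) ∧ ∀ x, ∑ y, W x y = 1

/-- Output distribution `PW`. -/
noncomputable def outDist {A B : Type*} [Fintype A] (P : A → ℝ) (W : A → B → ℝ) (y : B) : ℝ :=
  ∑ x, P x * W x y

/-- Mass of a set under a (sub)distribution. -/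
noncomputable def mass {Z : Type*} [Fintype Z] (p : Z → ℝ) (S : Set Z) : ℝ :=
  ∑ z, S.indicator p z

/-- `P×W(S)`. -/
noncomputable def jointMass {A B : Type*} [Fintype A] [Fintype B]
    (P : A → ℝ) (W : A → B → ℝ) (S : Set (A × B)) : ℝ :=
  mass (fun z : A × B => P z.1 * W z.1 z.2) S

/-- Variational distance between (sub)distributions. -/
noncomputable def tvDist {Z : Type*} [Fintype Z] (p q : Z → ℝ) : ℝ :=
  (1 / 2) * ∑ z, |p z - q z|

/-- Partial response `PW^S`. -/
noncomputable def partialResp {A B : Type*} [Fintype A] [Fintype B]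
    (P : A → ℝ) (W : A → B → ℝ) (S : Set (A × B)) (y : B) : ℝ :=
  ∑ x, S.indicator (fun z : A × B => P z.1 * W z.1 z.2) (x, y)

/-- `p` is an `M`-type: every value is an integer multiple of `1/M`. -/
def IsMType {Z : Type*} [Fintype Z] (M : ℕ) (p : Z → ℝ) : Prop :=
  ∀ z, ∃ k : ℕ, p z = (k : ℝ) / M

/-- `(N, ε, δ)`-ID code for channel `W`. -/
structure IsIDCode {A B : Type*} [Fintype A] [Fintype B] (W : A → B → ℝ) (N : ℕ)
    (P : Fin N → A → ℝ) (D : Fin N → Set B) (ε δ : ℝ) : Prop where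
  dist : ∀ i, IsDist (P i)
  typeI : ∀ i, mass (outDist (P i) W) (D i)ᶜ ≤ ε
  typeII : ∀ i j, i ≠ j → mass (outDist (P i) W) (D j) ≤ δ

/-- Existence of an `(N, ε, δ)`-ID code for channel `W`. -/
def ExistsIDCode {A B : Type*} [Fintype A] [Fintype B] (W : A → B → ℝ) (N : ℕ) (ε δ : ℝ) : Prop :=
  ∃ (P : Fin N → A → ℝ) (D : Fin N → Set B), IsIDCode W N P D ε δ

/-- `ε`-information spectrum divergence `D_s^ε(p‖q)`. -/
noncomputable def Ds {Z : Type*} [Fintype Z] (α : ℝ) (p q : Z → ℝ) : ℝ :=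
  sSup {γ : ℝ | mass p {z | p z ≤ Real.exp γ * q z} ≤ α}

/-- Optimal type II error `β_ε(p,q)` of binary hypothesis testing. -/
noncomputable def betaErr {Z : Type*} [Fintype Z] (ε : ℝ) (p q : Z → ℝ) : ℝ :=
  sInf {v : ℝ | ∃ t : Z → ℝ, (∀ z, 0 ≤ t z ∧ t z ≤ 1) ∧
    (∑ z, p z * (1 - t z)) ≤ ε ∧ v = ∑ z, q z * t z}

/-- A product weight built from a distribution has total mass one. -/
theorem sum_prod_eq_one {A : Type*} [Fintype A] {P : A → ℝ} (hP : IsDist P) (n : ℕ) :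
    ∑ c : Fin n → A, ∏ i, P (c i) = 1 := by
  have h := Finset.sum_pow' univ P n
  rw [Fintype.piFinset_univ, hP.2, one_pow] at h
  exact h.symm

/-- The second moment of a sum of independent centred variables. -/
theorem sum_prod_mul_sq_sum {A : Type*} [Fintype A] {P : A → ℝ} (hP : IsDist P)
    {g : A → ℝ} (hg : ∑ x, P x * g x = 0) (n : ℕ) :
    ∑ c : Fin n → A, (∏ i, P (c i)) * (∑ i, g (c i)) ^ 2 = n * ∑ x, P x * g x ^ 2 := by
  induction n with
  | zero => simp
  | succ n ih =>
    rw [← (Fin.consEquiv fun _ => A).sum_comp, Fintype.sum_prod_type]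
    have expand : ∀ (x : A) (c : Fin n → A),
        (∏ i, P ((Fin.consEquiv fun _ => A) (x, c) i)) *
            (∑ i, g ((Fin.consEquiv fun _ => A) (x, c) i)) ^ 2 =
          P x * g x ^ 2 * (∏ i, P (c i)) +
            2 * (P x * g x) * ((∏ i, P (c i)) * ∑ i, g (c i)) +
            P x * ((∏ i, P (c i)) * (∑ i, g (c i)) ^ 2) := by
      intro x c
      simp only [Fin.consEquiv, Equiv.coe_fn_mk, Fin.prod_univ_succ, Fin.sum_univ_succ,
        Fin.cons_zero, Fin.cons_succ]
      ring
    simp_rw [expand, sum_add_distrib, ← mul_sum, ← sum_mul, ← mul_sum]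
    rw [ih, sum_prod_eq_one hP, hg, hP.2]
    push_cast
    ring

/-- The expected deviation of an empirical mean from its expectation. -/
theorem sum_prod_mul_abs_empirical_sub_le {A : Type*} [Fintype A] {P : A → ℝ} (hP : IsDist P)
    (f : A → ℝ) {n : ℕ} (hn : 1 ≤ n) :
    ∑ c : Fin n → A, (∏ i, P (c i)) * |(∑ i, f (c i)) / n - ∑ x, P x * f x| ≤
      √((∑ x, P x * f x ^ 2) / n) := by
  set m := ∑ x, P x * f x with hm
  have hn0 : (0 : ℝ) < n := by exact_mod_cast hn
  have hcenter : ∑ x, P x * (f x - m) = 0 := by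
    simp_rw [mul_sub, sum_sub_distrib, ← sum_mul, hP.2, ← hm]
    ring
  have hvar : ∑ x, P x * (f x - m) ^ 2 = ∑ x, P x * f x ^ 2 - m ^ 2 := by
    have h : ∀ x, P x * (f x - m) ^ 2 = P x * f x ^ 2 - 2 * m * (P x * f x) + m ^ 2 * P x :=
      fun x => by ring
    simp_rw [h, sum_add_distrib, sum_sub_distrib, ← mul_sum, hP.2, ← hm]
    ring
  have hprod : ∀ c : Fin n → A, 0 ≤ ∏ i, P (c i) := fun c => prod_nonneg fun i _ => hP.1 _
  have hdev : ∀ c : Fin n → A, (∑ i, f (c i)) / n - m = (∑ i, (f (c i) - m)) / n := by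
    intro c
    rw [sum_sub_distrib]
    simp
    field_simp
  have hcs := sum_sq_le_sum_mul_sum_of_sq_le_mul univ
    (r := fun c : Fin n → A => (∏ i, P (c i)) * |(∑ i, f (c i)) / n - m|)
    (f := fun c => ∏ i, P (c i))
    (g := fun c => (∏ i, P (c i)) * ((∑ i, f (c i)) / n - m) ^ 2)
    (fun c _ => hprod c) (fun c _ => mul_nonneg (hprod c) (sq_nonneg _))
    (fun c _ => by rw [mul_pow, sq_abs]; exact le_of_eq (by ring))
  apply Real.le_sqrt_of_sq_le
  refine hcs.trans ?_
  simp_rw [hdev, div_pow, ← mul_div_assoc]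
  rw [← sum_div, sum_prod_eq_one hP, sum_prod_mul_sq_sum hP hcenter, hvar, one_mul,
    div_le_div_iff₀ (by positivity) hn0]
  nlinarith [mul_nonneg (sq_nonneg (n : ℝ)) (sq_nonneg m)]

/-- The partial response at `y` is the input average of the truncated channel. -/
theorem partialResp_eq_sum_mul {A B : Type*} [Fintype A] [Fintype B]
    (P : A → ℝ) (W : A → B → ℝ) (S : Set (A × B)) (y : B) :
    partialResp P W S y = ∑ x, P x * S.indicator (fun z => W z.1 z.2) (x, y) := by
  classical
  simp [partialResp, Set.indicator_apply]

/-- The partial response of the empirical distribution of a codebook. -/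
theorem partialResp_empirical {A B : Type*} [Fintype A] [DecidableEq A] [Fintype B]
    (W : A → B → ℝ) (S : Set (A × B)) {n : ℕ} (c : Fin n → A) (y : B) :
    partialResp (fun x => (∑ i, if c i = x then (1 : ℝ) else 0) / n) W S y =
      (∑ i, S.indicator (fun z => W z.1 z.2) (c i, y)) / n := by
  rw [partialResp_eq_sum_mul]
  simp_rw [div_mul_eq_mul_div, sum_mul]
  rw [← sum_div, sum_comm]
  simp

/-- The total mass of a partial response is at most one. -/
theorem sum_partialResp_le_one {A B : Type*} [Fintype A] [Fintype B]
    {P : A → ℝ} (hP : IsDist P) {W : A → B → ℝ} (hW : IsChannel W) (S : Set (A × B)) :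
    ∑ y, partialResp P W S y ≤ 1 := by
  simp_rw [partialResp_eq_sum_mul]
  rw [sum_comm]
  calc ∑ x, ∑ y, P x * S.indicator (fun z => W z.1 z.2) (x, y)
      ≤ ∑ x, ∑ y, P x * W x y := by
        refine sum_le_sum fun x _ => sum_le_sum fun y _ =>
          mul_le_mul_of_nonneg_left ?_ (hP.1 x)
        exact Set.indicator_le_self' (fun z _ => hW.1 z.1 z.2) (x, y)
    _ = 1 := by simp_rw [← mul_sum, hW.2, mul_one, hP.2]

/-- Soft covering lemma in expectation over a random codebook. -/
theorem soft_covering_expectation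
    {𝒳 𝒴 : Type*} [Fintype 𝒳] [DecidableEq 𝒳] [Fintype 𝒴]
    (W : 𝒳 → 𝒴 → ℝ) (hW : IsChannel W)
    (Q : 𝒴 → ℝ) (hQ : IsDist Q) (γ : ℝ)
    (P : 𝒳 → ℝ) (hP : IsDist P) (M : ℕ) (hM : 1 ≤ M) :
    ∑ c : Fin M → 𝒳, (∏ i, P (c i)) *
        tvDist
          (partialResp (fun x => (∑ i, if c i = x then (1 : ℝ) else 0) / M) W
            {z : 𝒳 × 𝒴 | W z.1 z.2 ≤ Real.exp γ * Q z.2})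
          (partialResp P W {z : 𝒳 × 𝒴 | W z.1 z.2 ≤ Real.exp γ * Q z.2}) ≤
      (1 / 2) * Real.sqrt (Real.exp γ / M) := by
  set S : Set (𝒳 × 𝒴) := {z | W z.1 z.2 ≤ Real.exp γ * Q z.2} with hS
  have hM0 : (0 : ℝ) < M := by exact_mod_cast hM
  have hind : ∀ x y, 0 ≤ S.indicator (fun z => W z.1 z.2) (x, y) :=
    fun x y => Set.indicator_nonneg (fun z _ => hW.1 z.1 z.2) _
  have hresp : ∀ y, 0 ≤ partialResp P W S y := fun y => by
    rw [partialResp_eq_sum_mul]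
    exact sum_nonneg fun x _ => mul_nonneg (hP.1 x) (hind x y)
  have hpoint : ∀ y, ∑ c : Fin M → 𝒳, (∏ i, P (c i)) *
      |partialResp (fun x => (∑ i, if c i = x then (1 : ℝ) else 0) / M) W S y -
        partialResp P W S y| ≤
      √(Real.exp γ / M) * (√(Q y) * √(partialResp P W S y)) := by
    intro y
    have hdev := sum_prod_mul_abs_empirical_sub_le hP
      (fun x => S.indicator (fun z => W z.1 z.2) (x, y)) hM
    simp_rw [← partialResp_eq_sum_mul, ← partialResp_empirical] at hdev
    refine hdev.trans ?_
    rw [← Real.sqrt_mul (hQ.1 y), ← Real.sqrt_mul (by positivity)]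
    apply Real.sqrt_le_sqrt
    rw [div_mul_eq_mul_div]
    gcongr
    rw [partialResp_eq_sum_mul, ← mul_assoc, mul_sum]
    refine sum_le_sum fun x _ => ?_
    have hle : S.indicator (fun z => W z.1 z.2) (x, y) ≤ Real.exp γ * Q y :=
      Set.indicator_apply_le' (fun h => h)
        (fun _ => mul_nonneg (Real.exp_pos γ).le (hQ.1 y))
    calc _ = P x * S.indicator (fun z => W z.1 z.2) (x, y) *
          S.indicator (fun z => W z.1 z.2) (x, y) := by ring
      _ ≤ P x * S.indicator (fun z => W z.1 z.2) (x, y) * (Real.exp γ * Q y) :=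
        mul_le_mul_of_nonneg_left hle (mul_nonneg (hP.1 x) (hind x y))
      _ = _ := by ring
  calc _ = (1 / 2) * ∑ y, ∑ c : Fin M → 𝒳, (∏ i, P (c i)) *
        |partialResp (fun x => (∑ i, if c i = x then (1 : ℝ) else 0) / M) W S y -
          partialResp P W S y| := by
        rw [sum_comm, mul_sum]
        refine sum_congr rfl fun c _ => ?_
        rw [tvDist, ← mul_sum]
        ring
    _ ≤ (1 / 2) * ∑ y, √(Real.exp γ / M) * (√(Q y) * √(partialResp P W S y)) := by
        gcongr with y
        exact hpoint y
    _ ≤ (1 / 2) * (√(Real.exp γ / M) * 1) := by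
        rw [← mul_sum]
        gcongr
        refine (Real.sum_sqrt_mul_sqrt_le univ hQ.1 hresp).trans ?_
        rw [hQ.2, Real.sqrt_one, one_mul, Real.sqrt_le_one]
        exact sum_partialResp_le_one hP hW S
    _ = (1 / 2) * Real.sqrt (Real.exp γ / M) := by rw [mul_one]
end

section
/- Let W be a channel from a finite alphabet 𝒳 to a finite alphabet 𝒴, let Q be a distribution on 𝒴, and let 0 ≤ ε < 1. Then the map P ↦ β_ε(P×W, P×Q) is convex on the set of distributions on 𝒳: for all distributions P_0, P_1 on 𝒳 and all λ ∈ [0,1], β_ε((λP_0 + (1−λ)P_1)×W, (λP_0 + (1−λ)P_1)×Q) ≤ λ β_ε(P_0×W, P_0×Q) + (1−λ) β_ε(P_1×W, P_1×Q). -/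
open Finset

/-- A weighted average of two points of `[0, 1]` with nonnegative weights lies in `[0, 1]`. -/
theorem exists_mem_unit_mul_add_eq {a b s t : ℝ} (ha : 0 ≤ a) (hb : 0 ≤ b)
    (hs : 0 ≤ s ∧ s ≤ 1) (ht : 0 ≤ t ∧ t ≤ 1) :
    ∃ u : ℝ, (0 ≤ u ∧ u ≤ 1) ∧ (a + b) * u = a * s + b * t := by
  have h₀ : 0 ≤ a * s + b * t := add_nonneg (mul_nonneg ha hs.1) (mul_nonneg hb ht.1)
  have h₁ : a * s + b * t ≤ a + b :=
    add_le_add (mul_le_of_le_one_right ha hs.2) (mul_le_of_le_one_right hb ht.2)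
  have hab : 0 ≤ a + b := add_nonneg ha hb
  refine ⟨(a * s + b * t) / (a + b), ⟨div_nonneg h₀ hab, div_le_one_of_le₀ h₁ hab⟩, ?_⟩
  exact mul_div_cancel_of_imp' fun h => le_antisymm (h ▸ h₁) h₀

/-- The type II error of any admissible test bounds `betaErr` from above. -/
theorem betaErr_le {Z : Type*} [Fintype Z] {ε : ℝ} {p q : Z → ℝ} (hq : ∀ z, 0 ≤ q z)
    {t : Z → ℝ} (ht : ∀ z, 0 ≤ t z ∧ t z ≤ 1) (hp : ∑ z, p z * (1 - t z) ≤ ε) :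
    betaErr ε p q ≤ ∑ z, q z * t z := by
  refine csInf_le ⟨0, ?_⟩ ⟨t, ht, hp, rfl⟩
  rintro v ⟨s, hs, -, rfl⟩
  exact sum_nonneg fun z _ => mul_nonneg (hq z) (hs z).1

/-- Admissible tests come arbitrarily close to `betaErr`. -/
theorem exists_test_lt_betaErr_add {Z : Type*} [Fintype Z] {ε δ : ℝ} (p q : Z → ℝ)
    (hε : 0 ≤ ε) (hδ : 0 < δ) :
    ∃ t : Z → ℝ, (∀ z, 0 ≤ t z ∧ t z ≤ 1) ∧ ∑ z, p z * (1 - t z) ≤ ε ∧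
      ∑ z, q z * t z < betaErr ε p q + δ := by
  have hne : {v : ℝ | ∃ t : Z → ℝ, (∀ z, 0 ≤ t z ∧ t z ≤ 1) ∧
      (∑ z, p z * (1 - t z)) ≤ ε ∧ v = ∑ z, q z * t z}.Nonempty :=
    ⟨_, fun _ => 1, by simp, by simpa using hε, rfl⟩
  obtain ⟨_, ⟨t, ht, hp, rfl⟩, hlt⟩ := Real.lt_sInf_add_pos hne hδ
  exact ⟨t, ht, hp, hlt⟩

/-- Convexity of `β_ε(P×W, P×Q)` in the input distribution `P`. -/
theorem beta_convex_in_input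
    {𝒳 𝒴 : Type*} [Fintype 𝒳] [Fintype 𝒴]
    (W : 𝒳 → 𝒴 → ℝ) (hW : IsChannel W) (Q : 𝒴 → ℝ) (hQ : IsDist Q)
    (ε : ℝ) (hε : 0 ≤ ε) (hε1 : ε < 1)
    (P₀ P₁ : 𝒳 → ℝ) (hP₀ : IsDist P₀) (hP₁ : IsDist P₁)
    (lam : ℝ) (hlam0 : 0 ≤ lam) (hlam1 : lam ≤ 1) :
    betaErr ε (fun z : 𝒳 × 𝒴 => (lam * P₀ z.1 + (1 - lam) * P₁ z.1) * W z.1 z.2)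
        (fun z : 𝒳 × 𝒴 => (lam * P₀ z.1 + (1 - lam) * P₁ z.1) * Q z.2) ≤
      lam * betaErr ε (fun z : 𝒳 × 𝒴 => P₀ z.1 * W z.1 z.2)
          (fun z : 𝒳 × 𝒴 => P₀ z.1 * Q z.2) +
        (1 - lam) * betaErr ε (fun z : 𝒳 × 𝒴 => P₁ z.1 * W z.1 z.2)
          (fun z : 𝒳 × 𝒴 => P₁ z.1 * Q z.2) := by
  have hlam1' : 0 ≤ 1 - lam := sub_nonneg.2 hlam1
  refine le_of_forall_pos_le_add fun δ hδ => ?_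
  obtain ⟨t₀, ht₀, hp₀, hq₀⟩ := exists_test_lt_betaErr_add
    (fun z : 𝒳 × 𝒴 => P₀ z.1 * W z.1 z.2) (fun z => P₀ z.1 * Q z.2) hε hδ
  obtain ⟨t₁, ht₁, hp₁, hq₁⟩ := exists_test_lt_betaErr_add
    (fun z : 𝒳 × 𝒴 => P₁ z.1 * W z.1 z.2) (fun z => P₁ z.1 * Q z.2) hε hδ
  have ha (x : 𝒳) : 0 ≤ lam * P₀ x := mul_nonneg hlam0 (hP₀.1 x)
  have hb (x : 𝒳) : 0 ≤ (1 - lam) * P₁ x := mul_nonneg hlam1' (hP₁.1 x)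
  choose t ht hmix using fun z : 𝒳 × 𝒴 =>
    exists_mem_unit_mul_add_eq (ha z.1) (hb z.1) (ht₀ z) (ht₁ z)
  have hp : ∑ z : 𝒳 × 𝒴, (lam * P₀ z.1 + (1 - lam) * P₁ z.1) * W z.1 z.2 * (1 - t z) =
      lam * ∑ z : 𝒳 × 𝒴, P₀ z.1 * W z.1 z.2 * (1 - t₀ z) +
        (1 - lam) * ∑ z : 𝒳 × 𝒴, P₁ z.1 * W z.1 z.2 * (1 - t₁ z) := by
    rw [mul_sum, mul_sum, ← sum_add_distrib]
    exact sum_congr rfl fun z _ => by linear_combination -W z.1 z.2 * hmix z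
  have hq : ∑ z : 𝒳 × 𝒴, (lam * P₀ z.1 + (1 - lam) * P₁ z.1) * Q z.2 * t z =
      lam * ∑ z : 𝒳 × 𝒴, P₀ z.1 * Q z.2 * t₀ z +
        (1 - lam) * ∑ z : 𝒳 × 𝒴, P₁ z.1 * Q z.2 * t₁ z := by
    rw [mul_sum, mul_sum, ← sum_add_distrib]
    exact sum_congr rfl fun z _ => by linear_combination Q z.2 * hmix z
  have hε' : ∑ z : 𝒳 × 𝒴, (lam * P₀ z.1 + (1 - lam) * P₁ z.1) * W z.1 z.2 * (1 - t z) ≤ ε := by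
    rw [hp]
    linarith only [mul_le_mul_of_nonneg_left hp₀ hlam0, mul_le_mul_of_nonneg_left hp₁ hlam1']
  have hβ := betaErr_le
    (p := fun z : 𝒳 × 𝒴 => (lam * P₀ z.1 + (1 - lam) * P₁ z.1) * W z.1 z.2)
    (q := fun z : 𝒳 × 𝒴 => (lam * P₀ z.1 + (1 - lam) * P₁ z.1) * Q z.2)
    (fun z => mul_nonneg (add_nonneg (ha z.1) (hb z.1)) (hQ.1 z.2)) ht hε'
  refine hβ.trans (hq.trans_le ?_)
  linarith only [mul_le_mul_of_nonneg_left hq₀.le hlam0,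
    mul_le_mul_of_nonneg_left hq₁.le hlam1']
end

section
/- Let W be a discrete memoryless channel from a finite alphabet 𝒳 to a finite alphabet 𝒴, let 0 < ε < 1 with V_ε(W) > 0, and let a ∈ ℝ be the real number with Φ(a) = ε, where Φ is the standard normal cumulative distribution function. Then for every 0 < δ < 1, the quantity √(V_ε(W))·a is an (ε,δ)-achievable second-order ID rate for W; equivalently, L_ID(ε,δ|W) ≥ √(V_ε(W))·a, where L_ID(ε,δ|W) is the supremum of (ε,δ)-achievable second-order ID rates. -/
open Finset

/-- Mutual information `I(P, W)`. -/
noncomputable def mutInfo {𝒳 𝒴 : Type*} [Fintype 𝒳] [Fintype 𝒴]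
    (P : 𝒳 → ℝ) (W : 𝒳 → 𝒴 → ℝ) : ℝ :=
  ∑ x, ∑ y, P x * W x y * Real.log (W x y / outDist P W y)

/-- Shannon capacity `C(W)`. -/
noncomputable def capacity {𝒳 𝒴 : Type*} [Fintype 𝒳] [Fintype 𝒴] (W : 𝒳 → 𝒴 → ℝ) : ℝ :=
  sSup {c : ℝ | ∃ P : 𝒳 → ℝ, IsDist P ∧ c = mutInfo P W}

/-- `P` is a capacity-achieving input distribution for `W`. -/
def CapacityAchieving {𝒳 𝒴 : Type*} [Fintype 𝒳] [Fintype 𝒴]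
    (P : 𝒳 → ℝ) (W : 𝒳 → 𝒴 → ℝ) : Prop :=
  IsDist P ∧ mutInfo P W = capacity W

/-- `D(W(·|x)‖Q)`. -/
noncomputable def divX {𝒳 𝒴 : Type*} [Fintype 𝒴] (W : 𝒳 → 𝒴 → ℝ) (Q : 𝒴 → ℝ) (x : 𝒳) : ℝ :=
  ∑ y, W x y * Real.log (W x y / Q y)

/-- Conditional information variance `V(W‖Q|P)`. -/
noncomputable def condInfoVar {𝒳 𝒴 : Type*} [Fintype 𝒳] [Fintype 𝒴]
    (W : 𝒳 → 𝒴 → ℝ) (Q : 𝒴 → ℝ) (P : 𝒳 → ℝ) : ℝ :=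
  ∑ x, P x * ∑ y, W x y * (Real.log (W x y / Q y) - divX W Q x) ^ 2

/-- `V_min(W)`: minimum conditional information variance over capacity-achieving input
distributions, evaluated at the (unique) capacity-achieving output distribution. -/
noncomputable def Vmin {𝒳 𝒴 : Type*} [Fintype 𝒳] [Fintype 𝒴] (W : 𝒳 → 𝒴 → ℝ) : ℝ :=
  sInf {v : ℝ | ∃ P : 𝒳 → ℝ, CapacityAchieving P W ∧ v = condInfoVar W (outDist P W) P}

/-- `V_max(W)`. -/
noncomputable def Vmax {𝒳 𝒴 : Type*} [Fintype 𝒳] [Fintype 𝒴] (W : 𝒳 → 𝒴 → ℝ) : ℝ :=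
  sSup {v : ℝ | ∃ P : 𝒳 → ℝ, CapacityAchieving P W ∧ v = condInfoVar W (outDist P W) P}

/-- The `α`-dispersion `V_α(W)`. -/
noncomputable def Vdisp {𝒳 𝒴 : Type*} [Fintype 𝒳] [Fintype 𝒴] (α : ℝ) (W : 𝒳 → 𝒴 → ℝ) : ℝ :=
  if α < 1 / 2 then Vmin W else Vmax W

/-- `n`-fold memoryless extension `W^n` of a DMC `W`. -/
noncomputable def prodChannel {𝒳 𝒴 : Type*} [Fintype 𝒳] [Fintype 𝒴]
    (W : 𝒳 → 𝒴 → ℝ) (n : ℕ) : (Fin n → 𝒳) → (Fin n → 𝒴) → ℝ :=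
  fun xs ys => ∏ k, W (xs k) (ys k)

/-- `L` is an `(ε,δ)`-achievable second-order ID rate for the DMC `W`. -/
def AchievableSecondOrderIDRate {𝒳 𝒴 : Type*} [Fintype 𝒳] [Fintype 𝒴]
    (W : 𝒳 → 𝒴 → ℝ) (ε δ L : ℝ) : Prop :=
  ∃ (N : ℕ → ℕ) (e d : ℕ → ℝ),
    (∀ n, 1 ≤ n → ExistsIDCode (prodChannel W n) (N n) (e n) (d n)) ∧
    Filter.limsup e Filter.atTop ≤ ε ∧
    Filter.limsup d Filter.atTop ≤ δ ∧
    L ≤ Filter.liminf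
        (fun n : ℕ => (Real.log (Real.log (N n)) - n * capacity W) / Real.sqrt n)
        Filter.atTop

/-- Standard normal cumulative distribution function `Φ`. -/
noncomputable def stdPhi (a : ℝ) : ℝ :=
  ∫ t in Set.Iic a, Real.exp (-t ^ 2 / 2) / Real.sqrt (2 * Real.pi)

open MeasureTheory ProbabilityTheory Filter Topology in
lemma stdPhi_eq_gaussianReal (c : ℝ) :
    stdPhi c = (gaussianReal 0 1 (Set.Iic c)).toReal := by
  rw [gaussianReal_apply_eq_integral 0 one_ne_zero, ENNReal.toReal_ofReal]
  · unfold stdPhi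
    refine integral_congr_ae (ae_of_all _ fun t => ?_)
    simp [gaussianPDFReal]
    ring
  · exact integral_nonneg fun t => gaussianPDFReal_nonneg _ _ _

lemma stdPhi_mono : Monotone stdPhi := by
  intro x y h
  simp only [stdPhi_eq_gaussianReal]
  exact MeasureTheory.measureReal_mono (Set.Iic_subset_Iic.2 h)

open MeasureTheory ProbabilityTheory Filter Topology in
/-- Central limit theorem for i.i.d. sums over a finite alphabet. -/
lemma tendsto_mass_sum_le {Z : Type*} [Fintype Z] {p : Z → ℝ} (hp : IsDist p) (f : Z → ℝ)
    {μ v : ℝ} (hμ : ∑ z, p z * f z = μ) (hv : ∑ z, p z * (f z - μ) ^ 2 = v) (hv0 : 0 < v) (b : ℝ) :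
    Tendsto (fun n : ℕ => mass (fun z : Fin n → Z => ∏ k, p (z k))
      {z | ∑ k, f (z k) ≤ n * μ + √n * b}) atTop (𝓝 (stdPhi (b / √v))) := by
  classical
  let _ : MeasurableSpace Z := ⊤
  have hsum : ∑ z, ENNReal.ofReal (p z) = 1 := by
    rw [← ENNReal.ofReal_sum_of_nonneg fun z _ => hp.1 z, hp.2, ENNReal.ofReal_one]
  let q : PMF Z := PMF.ofFintype (fun z => ENNReal.ofReal (p z)) hsum
  let m : Measure Z := q.toMeasure
  have hm (z : Z) : m {z} = ENNReal.ofReal (p z) := by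
    rw [PMF.toMeasure_apply_singleton _ _ (measurableSet_singleton z)]; rfl
  let P : Measure (ℕ → Z) := Measure.infinitePi (fun _ => m)
  have hint (g : Z → ℝ) : ∫ z, g z ∂m = ∑ z, p z * g z := by
    rw [PMF.integral_eq_sum]
    refine sum_congr rfl fun z _ => ?_
    simp [q, ENNReal.toReal_ofReal (hp.1 z)]
  let g : Z → ℝ := fun z => (f z - μ) / √v
  have hg (g : Z → ℝ) : Measurable g := measurable_from_top
  have hPint (g : Z → ℝ) : ∫ ω, g (ω 0) ∂P = ∑ z, p z * g z := by
    rw [← hint, ← Measure.infinitePi_map_eval (fun _ : ℕ => m) 0, integral_map]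
    · exact (measurable_pi_apply 0).aemeasurable
    · exact (hg g).aestronglyMeasurable
  have hsv : √v ≠ 0 := (Real.sqrt_pos.2 hv0).ne'
  have h0 : ∫ ω, g (ω 0) ∂P = 0 := by
    rw [hPint]
    simp only [g, mul_div_assoc', mul_sub, ← sum_div, sum_sub_distrib, hμ, ← sum_mul, hp.2]
    simp
  have h1 : ∫ ω, ((fun ω : ℕ → Z => g (ω 0)) ^ 2) ω ∂P = 1 := by
    rw [show ((fun ω : ℕ → Z => g (ω 0)) ^ 2) = fun ω => (fun z => g z ^ 2) (ω 0) from rfl, hPint]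
    simp only [g, div_pow, Real.sq_sqrt hv0.le, mul_div_assoc', ← sum_div, hv]
    exact div_self hv0.ne'
  have hindep : iIndepFun (fun (k : ℕ) (ω : ℕ → Z) => g (ω k)) P :=
    iIndepFun_infinitePi (X := fun _ => g) fun _ => hg g
  have hgω (i : ℕ) : Measurable fun ω : ℕ → Z => g (ω i) := (hg g).comp (measurable_pi_apply i)
  have hident (i : ℕ) : IdentDistrib (fun ω : ℕ → Z => g (ω i)) (fun ω => g (ω 0)) P P := by
    refine ⟨(hgω i).aemeasurable, (hgω 0).aemeasurable, ?_⟩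
    have key (j : ℕ) : P.map (fun ω : ℕ → Z => g (ω j)) = m.map g := by
      rw [← Measure.infinitePi_map_eval (fun _ : ℕ => m) j,
        Measure.map_map (hg g) (measurable_pi_apply j)]
      rfl
    rw [key, key]
  have hclt := tendstoInDistribution_inv_sqrt_mul_sum
    (Y := id) (P' := gaussianReal 0 1) (HasLaw.id) h0 h1 hindep hident
  have hna : NullSingletonClass (gaussianReal 0 1) := nullSingletonClass_gaussianReal one_ne_zero
  have hlim := ProbabilityMeasure.tendsto_measure_of_null_frontier_of_tendsto' hclt.tendsto
    (E := Set.Iic (b / √v)) (by simp)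
  simp only [ProbabilityMeasure.coe_mk, Measure.map_id] at hlim
  have hlim2 := (ENNReal.tendsto_toReal (measure_ne_top _ _)).comp hlim
  rw [← stdPhi_eq_gaussianReal] at hlim2
  refine hlim2.congr' ?_
  filter_upwards [eventually_gt_atTop 0] with n hn
  rw [Function.comp_apply, Measure.map_apply
    ((measurable_fun_sum _ fun k _ => hgω k).const_mul _) measurableSet_Iic]
  have hsn : 0 < √(n : ℝ) := Real.sqrt_pos.2 (by exact_mod_cast hn)
  have hset : (fun ω : ℕ → Z => (√(n : ℝ))⁻¹ * ∑ k ∈ range n, g (ω k)) ⁻¹' Set.Iic (b / √v) =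
      ⋃ z ∈ (univ.filter fun z : Fin n → Z => ∑ k, f (z k) ≤ n * μ + √n * b),
        {ω : ℕ → Z | ∀ k : Fin n, ω k = z k} := by
    have hiff (z : Fin n → Z) : (√(n : ℝ))⁻¹ * ∑ k, g (z k) ≤ b / √v ↔
        ∑ k, f (z k) ≤ n * μ + √n * b := by
      have hs : ∑ k, g (z k) = (∑ k, f (z k) - n * μ) / √v := by
        simp [g, ← sum_div]
      rw [hs, inv_mul_eq_div, div_div, mul_comm √v, ← div_div,
        div_le_div_iff_of_pos_right (Real.sqrt_pos.2 hv0), div_le_iff₀ hsn]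
      constructor <;> intro h <;> linarith
    ext ω
    simp only [Set.mem_preimage, Set.mem_Iic, Set.mem_iUnion, mem_filter, mem_univ, true_and,
      Set.mem_ofPred_eq, exists_prop]
    rw [← Fin.sum_univ_eq_sum_range (fun k => g (ω k)) n, hiff (fun k => ω k)]
    constructor
    · intro h
      exact ⟨fun k => ω k, h, fun _ => rfl⟩
    · rintro ⟨z, hz, h⟩
      simpa only [h] using hz
  have hcyl (z : Fin n → Z) : {ω : ℕ → Z | ∀ k : Fin n, ω k = z k} =
      Set.pi (range n : Set ℕ) (fun k => if h : k < n then {z ⟨k, h⟩} else Set.univ) := by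
    ext ω
    simp only [Set.mem_ofPred_eq, Set.mem_pi, coe_range, Set.mem_Iio]
    constructor
    · intro h k hk
      simp [hk, h ⟨k, hk⟩]
    · intro h k
      have := h k k.2
      simpa using this
  have hPz (z : Fin n → Z) : P {ω : ℕ → Z | ∀ k : Fin n, ω k = z k} =
      ENNReal.ofReal (∏ k, p (z k)) := by
    rw [hcyl, Measure.infinitePi_pi _ (fun k _ => by split_ifs <;> exact MeasurableSet.of_discrete),
      ENNReal.ofReal_prod_of_nonneg (fun k _ => hp.1 _), ← Fin.prod_univ_eq_prod_range]
    refine prod_congr rfl fun k _ => ?_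
    simp [hm]
  rw [hset, measure_biUnion_finset]
  · rw [ENNReal.toReal_sum fun z _ => measure_ne_top _ _, mass, sum_filter]
    refine sum_congr rfl fun z _ => ?_
    rw [hPz, ENNReal.toReal_ofReal (prod_nonneg fun k _ => hp.1 _)]
    simp [Set.indicator]
  · intro z _ z' _ hzz
    refine Set.disjoint_left.2 fun ω h h' => hzz ?_
    funext k
    exact (h k).symm.trans (h' k)
  · intro z _
    rw [hcyl]
    refine MeasurableSet.pi (Set.to_countable _) fun k _ => ?_
    split_ifs <;> exact MeasurableSet.of_discrete

section InformationQuantities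

variable {𝒳 𝒴 : Type*} [Fintype 𝒳] [Fintype 𝒴] {W : 𝒳 → 𝒴 → ℝ} {P : 𝒳 → ℝ}

lemma outDist_nonneg (hW : IsChannel W) (hP : IsDist P) (y : 𝒴) : 0 ≤ outDist P W y :=
  sum_nonneg fun x _ => mul_nonneg (hP.1 x) (hW.1 x y)

lemma IsDist.outDist (hW : IsChannel W) (hP : IsDist P) : IsDist (outDist P W) := by
  refine ⟨outDist_nonneg hW hP, ?_⟩
  simp only [_root_.outDist]
  rw [sum_comm]
  simp only [← mul_sum, hW.2, mul_one, hP.2]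

lemma mul_le_outDist (hW : IsChannel W) (hP : IsDist P) (x : 𝒳) (y : 𝒴) :
    P x * W x y ≤ outDist P W y :=
  single_le_sum (f := fun x => P x * W x y)
    (fun x _ => mul_nonneg (hP.1 x) (hW.1 x y)) (mem_univ x)

lemma outDist_pos (hW : IsChannel W) (hP : IsDist P) {x : 𝒳} {y : 𝒴} (hx : 0 < P x)
    (hxy : 0 < W x y) : 0 < outDist P W y :=
  (mul_pos hx hxy).trans_le (mul_le_outDist hW hP x y)

lemma mutInfo_eq_sum_divX : mutInfo P W = ∑ x, P x * divX W (outDist P W) x := by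
  simp only [mutInfo, divX, mul_sum, mul_assoc]

lemma mutInfo_le_card (hW : IsChannel W) (hP : IsDist P) :
    mutInfo P W ≤ Fintype.card 𝒳 * Fintype.card 𝒴 := by
  have hterm (x : 𝒳) (y : 𝒴) : P x * W x y * Real.log (W x y / outDist P W y) ≤ 1 := by
    rcases (hP.1 x).eq_or_lt with hx | hx
    · simp [← hx]
    rcases (hW.1 x y).eq_or_lt with hxy | hxy
    · simp [← hxy]
    have hQ := outDist_pos hW hP hx hxy
    have h1 : W x y / outDist P W y ≤ 1 / P x := by
      rw [div_le_div_iff₀ hQ hx, one_mul, mul_comm]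
      exact mul_le_outDist hW hP x y
    have h2 : Real.log (W x y / outDist P W y) ≤ 1 / P x :=
      (Real.log_le_self (div_nonneg hxy.le hQ.le)).trans h1
    have h3 : W x y ≤ 1 := (single_le_sum (fun y _ => hW.1 x y) (mem_univ y)).trans_eq (hW.2 x)
    calc _ ≤ P x * W x y * (1 / P x) := by gcongr
      _ = W x y := by field_simp
      _ ≤ 1 := h3
  calc _ ≤ ∑ _x : 𝒳, ∑ _y : 𝒴, (1 : ℝ) := sum_le_sum fun x _ => sum_le_sum fun y _ => hterm x y
    _ = _ := by simp

lemma mutInfo_le_capacity (hW : IsChannel W) (hP : IsDist P) : mutInfo P W ≤ capacity W := by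
  refine le_csSup ⟨Fintype.card 𝒳 * Fintype.card 𝒴, ?_⟩ ⟨P, hP, rfl⟩
  rintro _ ⟨P', hP', rfl⟩
  exact mutInfo_le_card hW hP'

open Classical in
/-- Moving an input distribution towards a point of its support changes the mutual information at
first order by the divergence of that point, up to a quadratic error. -/
lemma le_mutInfo_perturb (hW : IsChannel W) (hP : IsDist P) {x₀ : 𝒳} (hx₀ : 0 < P x₀)
    {t : ℝ} (ht : 0 < t) (ht1 : t < 1) :
    (1 - t) * mutInfo P W + t * divX W (outDist P W) x₀ -
        t ^ 2 * ∑ y, (W x₀ y - outDist P W y) ^ 2 / outDist P W y ≤ capacity W := by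
  set Q := outDist P W with hQ
  let P' : 𝒳 → ℝ := fun x => (1 - t) * P x + t * if x = x₀ then 1 else 0
  have hP'P (F : 𝒳 → ℝ) : ∑ x, P' x * F x = (1 - t) * ∑ x, P x * F x + t * F x₀ := by
    simp [P', add_mul, sum_add_distrib, mul_sum, mul_assoc]
  have hP' : IsDist P' := by
    refine ⟨fun x => ?_, ?_⟩
    · have := hP.1 x
      have : 0 ≤ 1 - t := by linarith
      positivity
    · simpa [hP.2] using hP'P fun _ => 1
  have hQ' (y : 𝒴) : outDist P' W y = Q y + t * (W x₀ y - Q y) := by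
    rw [hQ, outDist, hP'P fun x => W x y, outDist]
    ring
  have hsupp {x : 𝒳} (hx : 0 < P' x) : 0 < P x := by
    by_cases h : x = x₀
    · exact h ▸ hx₀
    · have h1 : P' x = (1 - t) * P x := by simp [P', h]
      rw [h1] at hx
      exact pos_of_mul_pos_right hx (by linarith)
  refine le_trans ?_ (mutInfo_le_capacity hW hP')
  have hterm (x : 𝒳) (y : 𝒴) : P' x * W x y * Real.log (W x y / Q y) +
      P' x * W x y * (1 - outDist P' W y / Q y) ≤
      P' x * W x y * Real.log (W x y / outDist P' W y) := by
    rcases (hP'.1 x).eq_or_lt with hx | hx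
    · simp [← hx]
    rcases (hW.1 x y).eq_or_lt with hxy | hxy
    · simp [← hxy]
    have hQ0 : 0 < Q y := outDist_pos hW hP (hsupp hx) hxy
    have hQ'0 := outDist_pos hW hP' hx hxy
    rw [← mul_add]
    refine mul_le_mul_of_nonneg_left ?_ (mul_nonneg hx.le hxy.le)
    rw [Real.log_div hxy.ne' hQ0.ne', Real.log_div hxy.ne' hQ'0.ne']
    have := Real.log_le_sub_one_of_pos (div_pos hQ'0 hQ0)
    rw [Real.log_div hQ'0.ne' hQ0.ne'] at this
    linarith
  have hsum := sum_le_sum fun x (_ : x ∈ univ) => sum_le_sum fun y (_ : y ∈ univ) => hterm x y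
  refine le_trans (le_of_eq ?_) hsum
  simp only [sum_add_distrib]
  have h1 : ∑ x, ∑ y, P' x * W x y * Real.log (W x y / Q y) =
      (1 - t) * mutInfo P W + t * divX W Q x₀ := by
    rw [mutInfo_eq_sum_divX, ← hQ, ← hP'P]
    simp only [divX, mul_sum, mul_assoc]
  have h2 : ∑ x, ∑ y, P' x * W x y * (1 - outDist P' W y / Q y) =
      - (t ^ 2 * ∑ y, (W x₀ y - Q y) ^ 2 / Q y) := by
    rw [sum_comm]
    have h3 (y : 𝒴) : ∑ x, P' x * W x y * (1 - outDist P' W y / Q y) =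
        - (t * (W x₀ y - Q y)) - t ^ 2 * ((W x₀ y - Q y) ^ 2 / Q y) := by
      rw [← sum_mul, ← outDist, hQ']
      rcases (outDist_nonneg hW hP y).eq_or_lt with h0 | h0
      · rw [← hQ] at h0
        have h4 : W x₀ y = 0 := by
          by_contra hne
          exact (outDist_pos hW hP hx₀ ((hW.1 x₀ y).lt_of_ne' hne)).ne h0
        simp [← h0, h4]
      · rw [← hQ] at h0
        field_simp
        ring
    rw [sum_congr rfl fun y _ => h3 y, sum_sub_distrib, sum_neg_distrib, ← mul_sum, ← mul_sum,
      sum_sub_distrib, hW.2, show ∑ y, Q y = 1 from (hP.outDist hW).2]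
    ring
  rw [h1, h2]
  ring

lemma CapacityAchieving.divX_le (hW : IsChannel W) (hP : CapacityAchieving P W) {x : 𝒳}
    (hx : 0 < P x) : divX W (outDist P W) x ≤ capacity W := by
  set K := ∑ y, (W x y - outDist P W y) ^ 2 / outDist P W y
  have hK : 0 ≤ K := sum_nonneg fun y _ => div_nonneg (sq_nonneg _) (outDist_nonneg hW hP.1 y)
  by_contra! hlt
  set d := divX W (outDist P W) x - capacity W with hd
  have hd0 : 0 < d := sub_pos.2 hlt
  have key {t : ℝ} (ht : 0 < t) (ht1 : t < 1) : d ≤ t * K := by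
    have h := le_mutInfo_perturb hW hP.1 hx ht ht1
    rw [hP.2] at h
    have h2 : t * d ≤ t * (t * K) := by
      rw [hd]
      linarith
    exact le_of_mul_le_mul_left h2 ht
  have h := key (t := d / (d + 2 * K + 1)) (by positivity)
    ((div_lt_one (by positivity)).2 (by linarith))
  rw [div_mul_eq_mul_div, le_div_iff₀ (by positivity)] at h
  nlinarith

/-- The Kuhn–Tucker condition on the support of a capacity-achieving input distribution. -/
lemma CapacityAchieving.divX_eq (hW : IsChannel W) (hP : CapacityAchieving P W) {x : 𝒳}
    (hx : 0 < P x) : divX W (outDist P W) x = capacity W := by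
  have hnn (z : 𝒳) (_ : z ∈ univ) : 0 ≤ P z * (capacity W - divX W (outDist P W) z) := by
    rcases (hP.1.1 z).eq_or_lt with h | h
    · simp [← h]
    · exact mul_nonneg h.le (sub_nonneg.2 (hP.divX_le hW h))
  have hsum : ∑ z, P z * (capacity W - divX W (outDist P W) z) = 0 := by
    simp only [mul_sub, sum_sub_distrib, ← sum_mul, hP.1.2, ← mutInfo_eq_sum_divX, hP.2]
    ring
  have h := (sum_eq_zero_iff_of_nonneg hnn).1 hsum x (mem_univ x)
  have := (mul_eq_zero.1 h).resolve_left hx.ne'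
  linarith

lemma condInfoVar_nonneg (hW : IsChannel W) (hP : IsDist P) (Q : 𝒴 → ℝ) :
    0 ≤ condInfoVar W Q P :=
  sum_nonneg fun x _ => mul_nonneg (hP.1 x)
    (sum_nonneg fun y _ => mul_nonneg (hW.1 x y) (sq_nonneg _))

lemma CapacityAchieving.capacity_pos (hW : IsChannel W) (hP : CapacityAchieving P W)
    (hV : 0 < condInfoVar W (outDist P W) P) : 0 < capacity W := by
  obtain ⟨x, -, hx⟩ := exists_ne_zero_of_sum_ne_zero hV.ne'
  obtain ⟨hx1, hx2⟩ := mul_ne_zero_iff.1 hx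
  obtain ⟨y, -, hy⟩ := exists_ne_zero_of_sum_ne_zero hx2
  obtain ⟨hy1, hy2⟩ := mul_ne_zero_iff.1 hy
  have hPx := (hP.1.1 x).lt_of_ne' hx1
  have hWy := (hW.1 x y).lt_of_ne' hy1
  have hD := hP.divX_eq hW hPx
  rw [hD] at hy2
  have hterm (y : 𝒴) : W x y - outDist P W y ≤
      W x y * Real.log (W x y / outDist P W y) := by
    rcases (hW.1 x y).eq_or_lt with h | h
    · simp [← h, outDist_nonneg hW hP.1 y]
    · have hQ := outDist_pos hW hP.1 hPx h
      have := Real.log_le_sub_one_of_pos (div_pos hQ h)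
      rw [← inv_div, Real.log_inv] at this
      have h2 : W x y * -Real.log (W x y / outDist P W y) ≤
        W x y * ((W x y / outDist P W y)⁻¹ - 1) := by gcongr
      rw [inv_div, mul_sub, mul_div_cancel₀ _ h.ne'] at h2
      linarith
  have hzero : ∑ y, (W x y - outDist P W y) = 0 := by
    rw [sum_sub_distrib, hW.2, (hP.1.outDist hW).2, sub_self]
  rw [← hD, divX, ← hzero]
  rcases eq_or_ne (W x y) (outDist P W y) with heq | hne
  · have hC : capacity W ≠ 0 := by
      intro hC
      apply hy2
      rw [hC, heq, div_self (heq ▸ hWy.ne')]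
      simp
    refine lt_of_le_of_ne (sum_le_sum fun y _ => hterm y) ?_
    rw [hzero, ← divX, hD]
    exact hC.symm
  · refine sum_lt_sum (fun y _ => hterm y) ⟨y, mem_univ y, ?_⟩
    have hQ := outDist_pos hW hP.1 hPx hWy
    have := Real.log_lt_sub_one_of_pos (div_pos hQ hWy) (by
      rw [Ne, div_eq_one_iff_eq hWy.ne']
      exact hne.symm)
    rw [← inv_div, Real.log_inv] at this
    have h2 := mul_lt_mul_of_pos_left this hWy
    rw [inv_div, mul_sub, mul_div_cancel₀ _ hWy.ne'] at h2
    linarith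

end InformationQuantities

section Mass

variable {Z : Type*} [Fintype Z] {p : Z → ℝ}

lemma mass_mono (hp : ∀ z, 0 ≤ p z) {S T : Set Z} (h : S ⊆ T) : mass p S ≤ mass p T :=
  sum_le_sum fun z _ => Set.indicator_le_indicator_of_subset h hp z

lemma mass_univ (p : Z → ℝ) : mass p Set.univ = ∑ z, p z := by simp [mass]

lemma mass_nonneg (hp : ∀ z, 0 ≤ p z) (S : Set Z) : 0 ≤ mass p S :=
  sum_nonneg fun z _ => Set.indicator_nonneg (fun z _ => hp z) z

lemma IsDist.mass_le_one (hp : IsDist p) (S : Set Z) : mass p S ≤ 1 := by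
  rw [← hp.2, ← mass_univ]
  exact mass_mono hp.1 (Set.subset_univ S)

lemma mass_union_le (hp : ∀ z, 0 ≤ p z) (S T : Set Z) :
    mass p (S ∪ T) ≤ mass p S + mass p T := by
  classical
  rw [mass, mass, mass, ← sum_add_distrib]
  refine sum_le_sum fun z _ => ?_
  have := hp z
  simp only [Set.indicator_apply, Set.mem_union]
  split_ifs <;> simp_all

lemma mass_iUnion_le {ι : Type*} [Fintype ι] (hp : ∀ z, 0 ≤ p z) (S : ι → Set Z) :
    mass p (⋃ i, S i) ≤ ∑ i, mass p (S i) := by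
  classical
  simp only [mass]
  rw [sum_comm]
  refine sum_le_sum fun z _ => ?_
  by_cases h : z ∈ ⋃ i, S i
  · obtain ⟨i, hi⟩ := Set.mem_iUnion.1 h
    rw [Set.indicator_of_mem h, ← Set.indicator_of_mem hi p]
    exact single_le_sum (f := fun i => (S i).indicator p z)
      (fun i _ => Set.indicator_nonneg (fun z _ => hp z) z) (mem_univ i)
  · rw [Set.indicator_of_notMem h]
    exact sum_nonneg fun i _ => Set.indicator_nonneg (fun z _ => hp z) z

lemma exists_notMem_of_mass_lt_one (hp : IsDist p) {S : Set Z} (hS : mass p S < 1) :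
    ∃ z, z ∉ S := by
  by_contra! h
  rw [Set.eq_univ_of_forall h, mass_univ, hp.2] at hS
  exact lt_irrefl _ hS

/-- Markov's inequality. -/
lemma mul_mass_le_sum (hp : ∀ z, 0 ≤ p z) {f : Z → ℝ} (hf : ∀ z, 0 ≤ f z) (r : ℝ) :
    r * mass p {z | r < f z} ≤ ∑ z, p z * f z := by
  classical
  rw [mass, mul_sum]
  refine sum_le_sum fun z _ => ?_
  simp only [Set.indicator_apply, Set.mem_ofPred_eq]
  split_ifs with h
  · rw [mul_comm]
    exact mul_le_mul_of_nonneg_left h.le (hp z)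
  · simpa using mul_nonneg (hp z) (hf z)

lemma mass_outDist {A B : Type*} [Fintype A] [Fintype B] (P : A → ℝ) (W : A → B → ℝ) (S : Set B) :
    mass (outDist P W) S = ∑ x, P x * mass (W x) S := by
  classical
  simp only [mass, mul_sum]
  rw [sum_comm]
  refine sum_congr rfl fun y _ => ?_
  by_cases h : y ∈ S <;> simp [h, outDist]

lemma IsDist.pi (hp : IsDist p) (M : ℕ) : IsDist fun z : Fin M → Z => ∏ k, p (z k) :=
  ⟨fun z => prod_nonneg fun k _ => hp.1 _, by rw [← Fintype.sum_pow, hp.2, one_pow]⟩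

/-- A Chernoff bound for the empirical mean of `[0, 1]`-valued i.i.d. samples. -/
lemma mass_empirical_mean_le (hp : IsDist p) {g : Z → ℝ} (hg0 : ∀ z, 0 ≤ g z)
    (hg1 : ∀ z, g z ≤ 1) {μ η : ℝ} (hμ : ∑ z, p z * g z ≤ μ) (hη : 0 < η) (hη1 : η ≤ 1) {M : ℕ}
    (hM : 0 < M) :
    mass (fun u : Fin M → Z => ∏ m, p (u m)) {u | μ + η < (∑ m, g (u m)) / M} ≤
      Real.exp (-(M * η ^ 2 / 4)) := by
  classical
  wlog hμ1 : μ ≤ 1 generalizing μ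
  · have h := mass_mono (p := fun u : Fin M → Z => ∏ m, p (u m)) (hp.pi M).1
      (S := {u | μ + η < (∑ m, g (u m)) / M}) (T := ∅) (by
        intro u hu
        simp only [Set.mem_ofPred_eq] at hu
        have : (∑ m, g (u m)) / M ≤ 1 := by
          rw [div_le_one (by exact_mod_cast hM)]
          simpa using sum_le_sum fun m (_ : m ∈ univ) => hg1 (u m)
        linarith)
    exact h.trans (by simpa [mass] using (Real.exp_pos _).le)
  set s := η / 2 with hs
  have hs0 : 0 < s := by positivity
  have hMpos : (0 : ℝ) < M := by exact_mod_cast hM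
  have hμ0 : 0 ≤ μ := (sum_nonneg fun z _ => mul_nonneg (hp.1 z) (hg0 z)).trans hμ
  have hexp : Real.exp s ≤ 1 + s + s ^ 2 := by
    have := Real.abs_exp_sub_one_sub_id_le (x := s) (by rw [abs_of_pos hs0]; linarith)
    have := (abs_le.1 this).2
    linarith
  have hconv (z : Z) : Real.exp (s * g z) ≤ 1 + g z * (Real.exp s - 1) := by
    have := convexOn_exp.2 (Set.mem_univ 0) (Set.mem_univ s) (sub_nonneg.2 (hg1 z)) (hg0 z) (by ring)
    simp only [smul_eq_mul, mul_zero, zero_add, Real.exp_zero, mul_one] at this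
    rw [mul_comm s]
    linarith
  have hmgf : ∑ z, p z * Real.exp (s * g z) ≤ Real.exp (μ * (s + s ^ 2)) := by
    calc _ ≤ ∑ z, p z * (1 + g z * (Real.exp s - 1)) :=
          sum_le_sum fun z _ => mul_le_mul_of_nonneg_left (hconv z) (hp.1 z)
      _ = 1 + (∑ z, p z * g z) * (Real.exp s - 1) := by
          simp only [mul_add, sum_add_distrib, mul_one, hp.2, sum_mul, mul_assoc]
      _ ≤ 1 + μ * (s + s ^ 2) := by
          have : 0 ≤ Real.exp s - 1 := sub_nonneg.2 (Real.one_le_exp hs0.le)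
          have h2 : Real.exp s - 1 ≤ s + s ^ 2 := by linarith
          gcongr
      _ ≤ _ := by
          rw [add_comm]
          exact Real.add_one_le_exp _
  calc _ ≤ ∑ u : Fin M → Z, (∏ m, p (u m)) *
        Real.exp (s * (∑ m, g (u m)) - s * (M * (μ + η))) := by
        refine sum_le_sum fun u _ => ?_
        have h0 : 0 ≤ ∏ m, p (u m) := (hp.pi M).1 u
        simp only [Set.indicator_apply, Set.mem_ofPred_eq]
        split_ifs with h
        · refine le_mul_of_one_le_right h0 (Real.one_le_exp ?_)
          rw [lt_div_iff₀ hMpos] at h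
          rw [← mul_sub]
          exact mul_nonneg hs0.le (by linarith)
        · positivity
    _ = (∑ z, p z * Real.exp (s * g z)) ^ M * Real.exp (-(s * (M * (μ + η)))) := by
        rw [Fintype.sum_pow, sum_mul]
        refine sum_congr rfl fun u _ => ?_
        rw [prod_mul_distrib, ← Real.exp_sum, ← mul_sum, sub_eq_add_neg, Real.exp_add, mul_assoc]
    _ ≤ (Real.exp (μ * (s + s ^ 2))) ^ M * Real.exp (-(s * (M * (μ + η)))) := by
        gcongr
        exact sum_nonneg fun z _ => mul_nonneg (hp.1 z) (Real.exp_pos _).le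
    _ ≤ _ := by
        rw [← Real.exp_nat_mul, ← Real.exp_add, Real.exp_le_exp]
        have : s ^ 2 * μ ≤ s ^ 2 * 1 := by gcongr
        have h2 : (M : ℝ) * (μ * s ^ 2 - s * η) ≤ M * (-(η ^ 2 / 4)) := by
          gcongr
          rw [hs] at this ⊢
          nlinarith
        linarith

/-- Greedy selection of points outside `S` which are pairwise unrelated by `R`. -/
lemma exists_pairwise_not_rel (hp : IsDist p) {S : Set Z} {R : Z → Z → Prop} {r : ℝ} (hr : 0 < r)
    (hr1 : r ≤ 1) (hS : mass p S ≤ r) (hR : ∀ v, mass p {u | R u v} ≤ r ^ 2) (N : ℕ)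
    (hN : 2 * (N + 1) * r < 1) :
    ∃ f : Fin N → Z, (∀ i, f i ∉ S) ∧ ∀ i j, i ≠ j → ¬ R (f i) (f j) := by
  classical
  set T : Set Z := {u | r < mass p {v | R u v}}
  have hT : mass p T ≤ r := by
    have h1 := mul_mass_le_sum hp.1 (f := fun u => mass p {v | R u v})
      (fun u => mass_nonneg hp.1 _) r
    have h2 : ∑ u, p u * mass p {v | R u v} = ∑ v, p v * mass p {u | R u v} := by
      simp only [mass, mul_sum, Set.indicator_apply, Set.mem_ofPred_eq]
      rw [sum_comm]
      refine sum_congr rfl fun v _ => sum_congr rfl fun u _ => ?_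
      split_ifs
      · ring
      · simp
    have h3 : ∑ v, p v * mass p {u | R u v} ≤ r ^ 2 := by
      calc _ ≤ ∑ v, p v * r ^ 2 := sum_le_sum fun v _ => mul_le_mul_of_nonneg_left (hR v) (hp.1 v)
        _ = r ^ 2 := by rw [← sum_mul, hp.2, one_mul]
    rw [h2] at h1
    have h4 : r * mass p T ≤ r * r := by linarith
    exact le_of_mul_le_mul_left h4 hr
  suffices h : ∃ f : Fin N → Z, (∀ i, f i ∉ S ∪ T) ∧ ∀ i j, i ≠ j → ¬ R (f i) (f j) by
    obtain ⟨f, h1, h2⟩ := h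
    exact ⟨f, fun i hi => h1 i (Or.inl hi), h2⟩
  induction N with
  | zero => exact ⟨Fin.elim0, fun i => i.elim0, fun i => i.elim0⟩
  | succ N ih =>
    push_cast at hN
    obtain ⟨f, hf, hfR⟩ := ih (by linarith)
    have hbad : mass p ((S ∪ T) ∪ ((⋃ i, {u | R u (f i)}) ∪ ⋃ i, {v | R (f i) v})) < 1 := by
      have h1 : mass p (⋃ i, {u | R u (f i)}) ≤ N * r := by
        refine (mass_iUnion_le hp.1 _).trans ?_
        calc _ ≤ ∑ _i : Fin N, r := sum_le_sum fun i _ => (hR (f i)).trans (by nlinarith)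
          _ = N * r := by simp
      have h2 : mass p (⋃ i, {v | R (f i) v}) ≤ N * r := by
        refine (mass_iUnion_le hp.1 _).trans ?_
        calc _ ≤ ∑ _i : Fin N, r := sum_le_sum fun i _ =>
              not_lt.1 fun h => hf i (Or.inr h)
          _ = N * r := by simp
      have h3 := mass_union_le hp.1 (S ∪ T) ((⋃ i, {u | R u (f i)}) ∪ ⋃ i, {v | R (f i) v})
      have h4 := mass_union_le hp.1 S T
      have h5 := mass_union_le hp.1 (⋃ i, {u | R u (f i)}) (⋃ i, {v | R (f i) v})
      linarith
    obtain ⟨z, hz⟩ := exists_notMem_of_mass_lt_one hp hbad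
    simp only [Set.mem_union, Set.mem_iUnion, Set.mem_ofPred_eq, not_or, not_exists] at hz
    refine ⟨Fin.cons z f, fun i => ?_, fun i j => ?_⟩
    · refine Fin.cases ?_ (fun i => ?_) i
      · simpa using hz.1
      · simpa using hf i
    · refine Fin.cases ?_ (fun i => ?_) i <;> refine Fin.cases ?_ (fun j => ?_) j
      · simp
      · intro _
        simpa using hz.2.1 j
      · intro _
        simpa using hz.2.2 i
      · intro hij
        simpa using hfR i j fun h => hij (by rw [h])

end Mass

/-- One-shot achievability: ID codes from random lists of `M` codewords with threshold decoding. -/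
lemma existsIDCode_of_threshold {A B : Type*} [Fintype A] [Fintype B] {W : A → B → ℝ}
    (hW : IsChannel W) {P : A → ℝ} (hP : IsDist P) {γ ε δ η : ℝ} (hγ : 0 < γ) (hη : 0 < η)
    (hη1 : η ≤ 1) (hηδ : η ≤ δ / 2)
    (hε : ∑ x, P x * mass (W x) {y | W x y ≤ γ * outDist P W y} ≤ ε)
    {M N : ℕ} (hM : 0 < M) (hMγ : M ≤ γ * δ / 2)
    (hN : 2 * (N + 1) * Real.exp (-(M * η ^ 2 / 8)) < 1) :
    ExistsIDCode W N (ε + η) δ := by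
  classical
  have hMpos : (0 : ℝ) < M := by exact_mod_cast hM
  have hWd (x : A) : IsDist (W x) := ⟨hW.1 x, hW.2 x⟩
  set Q := outDist P W with hQdef
  have hQ : IsDist Q := hP.outDist hW
  let enc (u : Fin M → A) (x : A) : ℝ := (∑ m, if u m = x then 1 else 0) / M
  let dec (u : Fin M → A) : Set B := ⋃ m, {y | γ * Q y < W (u m) y}
  have henc_sum (u : Fin M → A) (F : A → ℝ) : ∑ x, enc u x * F x = (∑ m, F (u m)) / M := by
    simp only [enc, div_mul_eq_mul_div, sum_mul, ← sum_div]
    rw [sum_comm]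
    simp
  have henc (u : Fin M → A) : IsDist (enc u) := by
    refine ⟨fun x => div_nonneg (sum_nonneg fun m _ => by split_ifs <;> simp) hMpos.le, ?_⟩
    have := henc_sum u fun _ => 1
    simpa [hMpos.ne'] using this
  have hout (u : Fin M → A) (S : Set B) :
      mass (outDist (enc u) W) S = (∑ m, mass (W (u m)) S) / M := by
    rw [mass_outDist, henc_sum u fun x => mass (W x) S]
  have hthr (x : A) : mass Q {y | γ * Q y < W x y} ≤ 1 / γ := by
    rw [le_div_iff₀ hγ, mul_comm, ← hW.2 x, mass, mul_sum]
    refine sum_le_sum fun y _ => ?_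
    by_cases h : y ∈ {y | γ * Q y < W x y}
    · rw [Set.indicator_of_mem h]
      exact le_of_lt h
    · rw [Set.indicator_of_notMem h, mul_zero]
      exact hW.1 x y
  have hdec (v : Fin M → A) : ∑ x, P x * mass (W x) (dec v) ≤ δ / 2 := by
    rw [← mass_outDist]
    calc _ ≤ ∑ m, mass Q {y | γ * Q y < W (v m) y} := mass_iUnion_le hQ.1 _
      _ ≤ ∑ _m : Fin M, 1 / γ := sum_le_sum fun m _ => hthr (v m)
      _ = M / γ := by simp [div_eq_mul_inv]
      _ ≤ δ / 2 := by
        rw [div_le_iff₀ hγ]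
        linarith
  have hr2 : Real.exp (-(M * η ^ 2 / 8)) ^ 2 = Real.exp (-(M * η ^ 2 / 4)) := by
    rw [← Real.exp_nat_mul]
    congr 1
    push_cast
    ring
  have hr1 : Real.exp (-(M * η ^ 2 / 8)) ≤ 1 := by
    rw [Real.exp_le_one_iff]
    have : 0 ≤ M * η ^ 2 / 8 := by positivity
    linarith
  have htail {g : A → ℝ} (hg0 : ∀ z, 0 ≤ g z) (hg1 : ∀ z, g z ≤ 1) {μ : ℝ}
      (hμ : ∑ z, P z * g z ≤ μ) :
      mass (fun u : Fin M → A => ∏ m, P (u m)) {u | μ + η < (∑ m, g (u m)) / M} ≤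
        Real.exp (-(M * η ^ 2 / 8)) ^ 2 := by
    rw [hr2]
    exact mass_empirical_mean_le hP hg0 hg1 hμ hη hη1 hM
  obtain ⟨f, hf, hfR⟩ := exists_pairwise_not_rel (hP.pi M)
    (S := {u | ε + η < (∑ m, mass (W (u m)) {y | W (u m) y ≤ γ * Q y}) / M})
    (R := fun u v => δ / 2 + η < (∑ m, mass (W (u m)) (dec v)) / M)
    (Real.exp_pos _) hr1
    ((htail (g := fun x => mass (W x) {y | W x y ≤ γ * Q y}) (fun x => mass_nonneg (hW.1 x) _)
      (fun x => (hWd x).mass_le_one _) hε).trans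
      (pow_le_of_le_one (Real.exp_pos _).le hr1 two_ne_zero))
    (fun v => htail (fun x => mass_nonneg (hW.1 x) _) (fun x => (hWd x).mass_le_one _) (hdec v))
    N hN
  refine ⟨fun i => enc (f i), fun i => dec (f i), fun i => henc _, fun i => ?_, fun i j hij => ?_⟩
  · refine le_trans ?_ (not_lt.1 (hf i))
    rw [hout]
    refine div_le_div_of_nonneg_right (sum_le_sum fun m _ => mass_mono (hW.1 _) ?_) hMpos.le
    intro y hy
    simp only [dec, Set.mem_compl_iff, Set.mem_iUnion, not_exists, Set.mem_ofPred_eq, not_lt] at hy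
    exact hy m
  · rw [hout]
    have := not_lt.1 (hfR i j hij)
    linarith

section ProductChannel

variable {𝒳 𝒴 : Type*} [Fintype 𝒳] [Fintype 𝒴] {W : 𝒳 → 𝒴 → ℝ} {P : 𝒳 → ℝ}

lemma IsChannel.prodChannel (hW : IsChannel W) (n : ℕ) : IsChannel (prodChannel W n) :=
  ⟨fun _ _ => prod_nonneg fun _ _ => hW.1 _ _, fun x => by
    classical
    have := prod_univ_sum (fun _ : Fin n => (univ : Finset 𝒴)) fun k y => W (x k) y
    simp only [Fintype.piFinset_univ, hW.2, prod_const_one] at this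
    exact this.symm⟩

lemma outDist_prodChannel (P : 𝒳 → ℝ) (W : 𝒳 → 𝒴 → ℝ) (n : ℕ) (y : Fin n → 𝒴) :
    outDist (fun x : Fin n → 𝒳 => ∏ k, P (x k)) (prodChannel W n) y =
      ∏ k, outDist P W (y k) := by
  classical
  simp only [outDist, prod_univ_sum, Fintype.piFinset_univ, prodChannel, prod_mul_distrib]

/-- The type I error of the threshold test is bounded by the tail of the information spectrum. -/
lemma sum_mass_threshold_le (hW : IsChannel W) (hP : IsDist P) (n : ℕ) (Γ : ℝ) :
    ∑ x : Fin n → 𝒳, (∏ k, P (x k)) * mass (prodChannel W n x)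
        {y | prodChannel W n x y ≤ Real.exp Γ *
          outDist (fun x : Fin n → 𝒳 => ∏ k, P (x k)) (prodChannel W n) y} ≤
      mass (fun z : Fin n → 𝒳 × 𝒴 => ∏ k, (P (z k).1 * W (z k).1 (z k).2))
        {z | ∑ k, Real.log (W (z k).1 (z k).2 / outDist P W (z k).2) ≤ Γ} := by
  classical
  simp only [outDist_prodChannel]
  simp only [mass, mul_sum]
  rw [← Fintype.sum_prod_type',
    ← (Equiv.arrowProdEquivProdArrow (Fin n) (fun _ => 𝒳) (fun _ => 𝒴)).sum_comp]
  refine sum_le_sum fun z _ => ?_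
  have hnn (k : Fin n) : 0 ≤ P (z k).1 * W (z k).1 (z k).2 := mul_nonneg (hP.1 _) (hW.1 _ _)
  rcases (prod_nonneg fun k (_ : k ∈ univ) => hnn k).eq_or_lt with h0 | hpos
  · refine le_trans (le_of_eq ?_) (Set.indicator_nonneg
      (fun z _ => prod_nonneg fun k _ => mul_nonneg (hP.1 _) (hW.1 _ _)) z)
    rw [prod_mul_distrib] at h0
    simp only [Equiv.arrowProdEquivProdArrow, Equiv.coe_fn_mk, Set.indicator_apply, prodChannel]
    split_ifs
    · exact h0.symm
    · simp
  · have hne (k : Fin n) : P (z k).1 * W (z k).1 (z k).2 ≠ 0 :=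
      fun h => hpos.ne' (prod_eq_zero (mem_univ k) h)
    have hPk (k : Fin n) : 0 < P (z k).1 := (hP.1 _).lt_of_ne' (left_ne_zero_of_mul (hne k))
    have hWk (k : Fin n) : 0 < W (z k).1 (z k).2 :=
      (hW.1 _ _).lt_of_ne' (right_ne_zero_of_mul (hne k))
    have hQk (k : Fin n) : 0 < outDist P W (z k).2 := outDist_pos hW hP (hPk k) (hWk k)
    simp only [Equiv.arrowProdEquivProdArrow, Equiv.coe_fn_mk, Set.indicator_apply, prodChannel,
      Set.mem_ofPred_eq]
    by_cases h : ∏ k, W (z k).1 (z k).2 ≤ Real.exp Γ * ∏ k, outDist P W (z k).2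
    · have hlog : ∑ k, Real.log (W (z k).1 (z k).2 / outDist P W (z k).2) ≤ Γ := by
        rw [← Real.log_prod fun k _ => (div_pos (hWk k) (hQk k)).ne', prod_div_distrib,
          Real.log_le_iff_le_exp (div_pos (prod_pos fun k _ => hWk k) (prod_pos fun k _ => hQk k)),
          div_le_iff₀ (prod_pos fun k _ => hQk k)]
        exact h
      rw [if_pos h, if_pos hlog, prod_mul_distrib]
    · rw [if_neg h, mul_zero]
      split_ifs
      · exact hpos.le
      · rfl

end ProductChannel

section Asymptotics

open Filter Topology

variable {𝒳 𝒴 : Type*} [Fintype 𝒳] [Fintype 𝒴] {W : 𝒳 → 𝒴 → ℝ} {P : 𝒳 → ℝ}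

/-- The information density of the product channel obeys a central limit theorem. -/
lemma CapacityAchieving.eventually_sum_mass_threshold_le (hW : IsChannel W)
    (hP : CapacityAchieving P W) (hV : 0 < condInfoVar W (outDist P W) P) {b c : ℝ}
    (hc : stdPhi (b / √(condInfoVar W (outDist P W) P)) < c) :
    ∀ᶠ n : ℕ in atTop, ∑ x, (∏ k, P (x k)) * mass (prodChannel W n x)
      {y | prodChannel W n x y ≤ Real.exp (n * capacity W + √n * b) *
        outDist (fun x => ∏ k, P (x k)) (prodChannel W n) y} ≤ c := by
  have hp : IsDist fun z : 𝒳 × 𝒴 => P z.1 * W z.1 z.2 := by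
    refine ⟨fun z => mul_nonneg (hP.1.1 _) (hW.1 _ _), ?_⟩
    simp only [Fintype.sum_prod_type, ← mul_sum, hW.2, mul_one, hP.1.2]
  have hμ : ∑ z : 𝒳 × 𝒴, P z.1 * W z.1 z.2 * Real.log (W z.1 z.2 / outDist P W z.2) =
      capacity W := by
    rw [Fintype.sum_prod_type, ← hP.2, mutInfo]
  have hv : ∑ z : 𝒳 × 𝒴, P z.1 * W z.1 z.2 *
      (Real.log (W z.1 z.2 / outDist P W z.2) - capacity W) ^ 2 =
      condInfoVar W (outDist P W) P := by
    rw [Fintype.sum_prod_type, condInfoVar]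
    refine sum_congr rfl fun x _ => ?_
    rcases (hP.1.1 x).eq_or_lt with hx | hx
    · simp [← hx]
    · simp only [hP.divX_eq hW hx, mul_sum, mul_assoc]
  filter_upwards [(tendsto_mass_sum_le hp _ hμ hv hV b).eventually_lt_const hc] with n hn
  exact (sum_mass_threshold_le hW hP.1 n _).trans hn.le

lemma tendsto_natCast_mul_add_sqrt_mul {C : ℝ} (hC : 0 < C) (b : ℝ) :
    Tendsto (fun n : ℕ => n * C + √n * b) atTop atTop := by
  have hs : Tendsto (fun n : ℕ => √(n : ℝ)) atTop atTop :=
    Real.tendsto_sqrt_atTop.comp tendsto_natCast_atTop_atTop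
  refine (hs.atTop_mul_atTop₀ (tendsto_atTop_add_const_right _ b (hs.atTop_mul_const hC))).congr
    fun n => ?_
  rw [mul_add, ← mul_assoc, Real.mul_self_sqrt n.cast_nonneg]

/-- A doubly exponential code size is beaten by the decay coming from a blocklength that is
larger by a factor `exp (√n * η)`. -/
lemma eventually_codeSize_lt {C δ κ η : ℝ} (hC : 0 < C) (hδ : 0 < δ) (hκ : 0 < κ) (hκ1 : κ ≤ 1)
    (hη : 0 < η) (b : ℝ) :
    ∀ᶠ n : ℕ in atTop, 0 < ⌊Real.exp (n * C + √n * b) * δ / 2⌋₊ ∧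
      2 * ((⌈Real.exp (Real.exp (n * C + √n * (b - η)))⌉₊ : ℝ) + 1) *
        Real.exp (-((⌊Real.exp (n * C + √n * b) * δ / 2⌋₊ : ℝ) * κ ^ 2 / 8)) < 1 := by
  have hs : Tendsto (fun n : ℕ => √(n : ℝ)) atTop atTop :=
    Real.tendsto_sqrt_atTop.comp tendsto_natCast_atTop_atTop
  have hγ := Real.tendsto_exp_atTop.comp (tendsto_natCast_mul_add_sqrt_mul hC b)
  have hdecay : Tendsto (fun n : ℕ => Real.exp (-(√(n : ℝ) * η))) atTop (𝓝 0) :=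
    Real.tendsto_exp_neg_atTop_nhds_zero.comp (hs.atTop_mul_const hη)
  have hc : 0 < δ * κ ^ 2 / 16 := by positivity
  filter_upwards [hγ.eventually_ge_atTop (2 / δ), hγ.eventually_gt_atTop (6 / (δ * κ ^ 2 / 16)),
    hdecay.eventually_lt_const (half_pos hc)] with n h₁ h₂ h₃
  simp only [Function.comp_apply] at h₁ h₂
  have hE : Real.exp (n * C + √n * (b - η)) =
      Real.exp (n * C + √n * b) * Real.exp (-(√(n : ℝ) * η)) := by
    rw [← Real.exp_add]
    ring_nf
  rw [hE]
  set γ := Real.exp (n * C + √n * b)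
  set c := δ * κ ^ 2 / 16 with hcdef
  have hγ0 : 0 < γ := Real.exp_pos _
  have hr0 : 0 < Real.exp (-(√(n : ℝ) * η)) := Real.exp_pos _
  set r := Real.exp (-(√(n : ℝ) * η))
  rw [div_le_iff₀ hδ] at h₁
  rw [div_lt_iff₀ hc] at h₂
  refine ⟨Nat.floor_pos.2 (by linarith), ?_⟩
  have hfloor : γ * δ / 2 - 1 < ⌊γ * δ / 2⌋₊ := Nat.sub_one_lt_floor _
  have hκ2 : κ ^ 2 ≤ 1 := pow_le_one₀ hκ.le hκ1
  have hM : γ * c - 1 ≤ (⌊γ * δ / 2⌋₊ : ℝ) * κ ^ 2 / 8 := by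
    have := mul_le_mul_of_nonneg_right hfloor.le (sq_nonneg κ)
    rw [hcdef]
    linarith
  have hexp1 : (1 : ℝ) ≤ Real.exp (γ * r) := Real.one_le_exp (mul_pos hγ0 hr0).le
  have hceil : (⌈Real.exp (γ * r)⌉₊ : ℝ) < Real.exp (γ * r) + 1 :=
    Nat.ceil_lt_add_one (by positivity)
  calc 2 * ((⌈Real.exp (γ * r)⌉₊ : ℝ) + 1) * Real.exp (-((⌊γ * δ / 2⌋₊ : ℝ) * κ ^ 2 / 8))
      ≤ 6 * Real.exp (γ * r) * Real.exp (-(γ * c - 1)) := by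
        rw [show 6 * Real.exp (γ * r) = 2 * (3 * Real.exp (γ * r)) by ring]
        gcongr
        linarith
    _ = 6 * Real.exp (γ * r - (γ * c - 1)) := by
        rw [mul_assoc, ← Real.exp_add, ← sub_eq_add_neg]
    _ ≤ 6 * Real.exp (-2) := by
        have := mul_le_mul_of_nonneg_left h₃.le hγ0.le
        gcongr
        linarith
    _ < 1 := by
        have : (6 : ℝ) < Real.exp 2 := by
          have h := Real.exp_one_gt_d9
          have : Real.exp 2 = Real.exp 1 * Real.exp 1 := by
            rw [← Real.exp_add]
            norm_num
          nlinarith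
        rw [Real.exp_neg, ← div_eq_mul_inv, div_lt_one (Real.exp_pos _)]
        exact this

lemma ExistsIDCode.mono {A B : Type*} [Fintype A] [Fintype B] {W : A → B → ℝ} {N : ℕ}
    {ε ε' δ : ℝ} (h : ExistsIDCode W N ε δ) (hε : ε ≤ ε') : ExistsIDCode W N ε' δ := by
  obtain ⟨P, D, hP, hI, hII⟩ := h
  exact ⟨P, D, hP, fun i => (hI i).trans hε, hII⟩

/-- A capacity-achieving input distribution attains, up to `η`, the Gaussian second-order rate
given by its own dispersion. -/
lemma CapacityAchieving.eventually_existsIDCode (hW : IsChannel W)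
    (hP : CapacityAchieving P W) (hV : 0 < condInfoVar W (outDist P W) P) {a δ η L : ℝ}
    (hδ : 0 < δ) (hδ1 : δ < 1) (hη : 0 < η)
    (hL : L ≤ √(condInfoVar W (outDist P W) P) * a) :
    ∀ᶠ n : ℕ in atTop, ExistsIDCode (prodChannel W n)
      ⌈Real.exp (Real.exp (n * capacity W + √n * (L - η)))⌉₊ (stdPhi a + η) δ := by
  set V := condInfoVar W (outDist P W) P
  have hκ : 0 < min (η / 2) (δ / 2) := lt_min (half_pos hη) (half_pos hδ)
  have hκδ : min (η / 2) (δ / 2) ≤ δ / 2 := min_le_right _ _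
  have hκη : min (η / 2) (δ / 2) ≤ η / 2 := min_le_left _ _
  set κ := min (η / 2) (δ / 2)
  have hb : stdPhi (L / √V) < stdPhi a + η / 2 := by
    have := stdPhi_mono ((div_le_iff₀' (Real.sqrt_pos.2 hV)).2 hL)
    linarith
  filter_upwards [hP.eventually_sum_mass_threshold_le hW hV hb,
    eventually_codeSize_lt (hP.capacity_pos hW hV) hδ hκ (by linarith) hη L] with n h₁ h₂
  exact (existsIDCode_of_threshold (hW.prodChannel n) (hP.1.pi n) (Real.exp_pos _) hκ
    (by linarith) hκδ h₁ h₂.1 (Nat.floor_le (by positivity)) h₂.2).mono (by linarith)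

/-- The dispersion is approached by capacity-achieving distributions. -/
lemma exists_capacityAchieving_lt_sqrt_mul (hW : IsChannel W) {a : ℝ}
    (hV : 0 < Vdisp (stdPhi a) W) {L : ℝ} (hL : L < √(Vdisp (stdPhi a) W) * a) :
    ∃ P, CapacityAchieving P W ∧ 0 < condInfoVar W (outDist P W) P ∧
      L ≤ √(condInfoVar W (outDist P W) P) * a := by
  have hcont : Continuous fun v : ℝ => √v * a := by fun_prop
  obtain ⟨ρ, hρ, hball⟩ := Metric.eventually_nhds_iff.1
    ((hcont.continuousAt (x := Vdisp (stdPhi a) W)).eventually_const_lt hL)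
  set S := {v : ℝ | ∃ P : 𝒳 → ℝ, CapacityAchieving P W ∧ v = condInfoVar W (outDist P W) P}
    with hS
  by_cases ha : stdPhi a < 1 / 2
  · have hVS : Vdisp (stdPhi a) W = sInf S := by rw [Vdisp, if_pos ha, Vmin]
    rw [hVS] at hV hball
    have hne : S.Nonempty := by
      by_contra h
      rw [Set.not_nonempty_iff_eq_empty.1 h, Real.sInf_empty] at hV
      exact hV.false
    have hbdd : BddBelow S := ⟨0, by
      rintro _ ⟨P, hP, rfl⟩
      exact condInfoVar_nonneg hW hP.1 _⟩
    obtain ⟨_, ⟨P, hP, rfl⟩, hlt⟩ := exists_lt_of_csInf_lt hne (lt_add_of_pos_right (sInf S) hρ)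
    have hle : sInf S ≤ condInfoVar W (outDist P W) P := csInf_le hbdd ⟨P, hP, rfl⟩
    refine ⟨P, hP, hV.trans_le hle, (hball ?_).le⟩
    rw [Real.dist_eq, abs_lt]
    constructor <;> linarith
  · have hVS : Vdisp (stdPhi a) W = sSup S := by rw [Vdisp, if_neg ha, Vmax]
    rw [hVS] at hV hball
    have hne : S.Nonempty := by
      by_contra h
      rw [Set.not_nonempty_iff_eq_empty.1 h, Real.sSup_empty] at hV
      exact hV.false
    have hbdd : BddAbove S := by
      by_contra h
      rw [Real.sSup_of_not_bddAbove h] at hV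
      exact hV.false
    obtain ⟨_, ⟨P, hP, rfl⟩, hlt⟩ := exists_lt_of_lt_csSup hne
      (show sSup S - min ρ (sSup S) < sSup S from sub_lt_self _ (lt_min hρ hV))
    have hle : condInfoVar W (outDist P W) P ≤ sSup S := le_csSup hbdd ⟨P, hP, rfl⟩
    have h₁ := min_le_left ρ (sSup S)
    have h₂ := min_le_right ρ (sSup S)
    refine ⟨P, hP, by linarith, (hball ?_).le⟩
    rw [Real.dist_eq, abs_lt]
    constructor <;> linarith

lemma eventually_existsIDCode (hW : IsChannel W) {a δ η : ℝ} (hV : 0 < Vdisp (stdPhi a) W)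
    (hδ : 0 < δ) (hδ1 : δ < 1) (hη : 0 < η) :
    ∀ᶠ n : ℕ in atTop, ExistsIDCode (prodChannel W n)
      ⌈Real.exp (Real.exp (n * capacity W + √n * (√(Vdisp (stdPhi a) W) * a - η)))⌉₊
      (stdPhi a + η) δ := by
  obtain ⟨P, hP, hPV, hL⟩ := exists_capacityAchieving_lt_sqrt_mul hW hV
    (sub_lt_self (√(Vdisp (stdPhi a) W) * a) (half_pos hη))
  filter_upwards [hP.eventually_existsIDCode hW hPV hδ hδ1 (half_pos hη) hL] with n hn
  rw [sub_sub, add_halves] at hn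
  exact hn.mono (by linarith)

/-- Diagonalisation: properties that hold eventually for every fixed `k` hold eventually along
some `k n → ∞`. -/
lemma exists_tendsto_atTop_eventually {Q : ℕ → ℕ → Prop} (hQ : ∀ k, ∀ᶠ n in atTop, Q k n) :
    ∃ k : ℕ → ℕ, Tendsto k atTop atTop ∧ ∀ᶠ n in atTop, Q (k n) n := by
  classical
  refine ⟨fun n => Nat.findGreatest (Q · n) n, tendsto_atTop.2 fun m => ?_, ?_⟩
  · filter_upwards [hQ m, eventually_ge_atTop m] with n hn hmn
    exact Nat.le_findGreatest hmn hn
  · filter_upwards [hQ 0] with n hn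
    exact Nat.findGreatest_spec (P := (Q · n)) n.zero_le hn

lemma le_log_log_ceil_exp_exp {x : ℝ} : x ≤ Real.log (Real.log ⌈Real.exp (Real.exp x)⌉₊) := by
  have h : Real.exp x ≤ Real.log ⌈Real.exp (Real.exp x)⌉₊ :=
    (Real.le_log_iff_exp_le ((Real.exp_pos _).trans_le (Nat.le_ceil _))).2 (Nat.le_ceil _)
  rwa [Real.le_log_iff_exp_le ((Real.exp_pos _).trans_le h)]

lemma log_log_ceil_exp_exp_le {x : ℝ} (hx : 0 ≤ x) :
    Real.log (Real.log ⌈Real.exp (Real.exp x)⌉₊) ≤ x + Real.log 2 := by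
  have hexp : 2 ≤ Real.exp (Real.exp x) := by
    linarith [Real.add_one_le_exp (Real.exp x), Real.one_le_exp hx]
  have hceil : 1 < (⌈Real.exp (Real.exp x)⌉₊ : ℝ) := by
    linarith [Nat.le_ceil (Real.exp (Real.exp x))]
  have h : Real.log ⌈Real.exp (Real.exp x)⌉₊ ≤ Real.exp x * 2 := by
    rw [Real.log_le_iff_le_exp (by linarith), mul_two, Real.exp_add]
    nlinarith [Nat.ceil_lt_add_one (Real.exp_pos (Real.exp x)).le]
  refine (Real.log_le_log (Real.log_pos hceil) h).trans_eq ?_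
  rw [Real.log_mul (Real.exp_pos _).ne' two_ne_zero, Real.log_exp]

lemma tendsto_secondOrder_rate {C L : ℝ} (hC : 0 < C) {η : ℕ → ℝ} (hη : Tendsto η atTop (𝓝 0)) :
    Tendsto (fun n : ℕ => (Real.log (Real.log
      ⌈Real.exp (Real.exp (n * C + √n * (L - η n)))⌉₊) - n * C) / √n) atTop (𝓝 L) := by
  have hs : Tendsto (fun n : ℕ => √(n : ℝ)) atTop atTop :=
    Real.tendsto_sqrt_atTop.comp tendsto_natCast_atTop_atTop
  have hlow : Tendsto (fun n => L - η n) atTop (𝓝 L) := by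
    simpa using hη.const_sub L
  have hup : Tendsto (fun n : ℕ => L - η n + Real.log 2 / √n) atTop (𝓝 L) := by
    simpa using hlow.add (hs.const_div_atTop (Real.log 2))
  refine tendsto_of_tendsto_of_tendsto_of_le_of_le' hlow hup ?_ ?_
  · filter_upwards [hs.eventually_gt_atTop 0] with n hn
    rw [le_div_iff₀ hn, mul_comm, le_sub_iff_add_le']
    exact le_log_log_ceil_exp_exp
  · filter_upwards [hs.eventually_gt_atTop 0, hη.eventually_lt_const one_pos,
      (tendsto_natCast_mul_add_sqrt_mul hC (L - 1)).eventually_ge_atTop 0] with n hn hη1 h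
    have := mul_le_mul_of_nonneg_left (show L - 1 ≤ L - η n by linarith) hn.le
    rw [div_le_iff₀ hn, add_mul, div_mul_cancel₀ _ hn.ne', sub_le_iff_le_add]
    refine (log_log_ceil_exp_exp_le (by linarith)).trans_eq ?_
    ring

end Asymptotics

/-- Second-order achievability for identification via a DMC:
`√(V_ε(W))·Φ⁻¹(ε)` is an `(ε,δ)`-achievable second-order ID rate for every `0 < δ < 1`. -/
theorem second_order_ID_achievability
    {𝒳 𝒴 : Type*} [Fintype 𝒳] [Fintype 𝒴]
    (W : 𝒳 → 𝒴 → ℝ) (hW : IsChannel W)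
    (ε : ℝ) (hε : 0 < ε) (hε1 : ε < 1) (hV : 0 < Vdisp ε W)
    (a : ℝ) (ha : stdPhi a = ε)
    (δ : ℝ) (hδ : 0 < δ) (hδ1 : δ < 1) :
    AchievableSecondOrderIDRate W ε δ (Real.sqrt (Vdisp ε W) * a) := by
  classical
  subst ha
  obtain ⟨P, hP, hPV, -⟩ := exists_capacityAchieving_lt_sqrt_mul hW hV (sub_one_lt _)
  set L := Real.sqrt (Vdisp (stdPhi a) W) * a
  obtain ⟨k, hk, hcode⟩ := exists_tendsto_atTop_eventually fun j =>
    eventually_existsIDCode hW hV hδ hδ1 (Nat.one_div_pos_of_nat (α := ℝ) (n := j))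
  have hη : Filter.Tendsto (fun n => 1 / ((k n : ℝ) + 1)) Filter.atTop (nhds 0) :=
    tendsto_one_div_add_atTop_nhds_zero_nat.comp hk
  set N : ℕ → ℕ := fun n =>
    ⌈Real.exp (Real.exp (n * capacity W + Real.sqrt n * (L - 1 / ((k n : ℝ) + 1))))⌉₊
  set e : ℕ → ℝ := fun n => stdPhi a + 1 / ((k n : ℝ) + 1)
  refine ⟨fun n => if ExistsIDCode (prodChannel W n) (N n) (e n) δ then N n else 0, e,
    fun _ => δ, fun n _ => ?_, ?_, (Filter.limsup_const δ).le, ?_⟩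
  · dsimp only
    split_ifs with h
    · exact h
    · exact ⟨fun i => i.elim0, fun i => i.elim0, fun i => i.elim0, fun i => i.elim0,
        fun i => i.elim0⟩
  · have he := hη.const_add (stdPhi a)
    rw [add_zero] at he
    exact he.limsup_eq.le
  · refine ((tendsto_secondOrder_rate (L := L) (hP.capacity_pos hW hPV) hη).congr' ?_).liminf_eq.ge
    filter_upwards [hcode] with n hn
    replace hn : ExistsIDCode (prodChannel W n) (N n) (e n) δ := hn
    rw [if_pos hn]
end
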